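/- For every integer k ≥ 3, Σ_{j=2}^{k−1} 2^{j} ζ(j, k−j) = (k+1) ζ(k). -/

import Mathlib

/-- The double zeta value `ζ(j, l) = Σ_{m>n>0} 1/(m^j n^l)`. -/
noncomputable def doubleZeta (j l : ℕ) : ℝ :=
  ∑' p : {p : ℕ × ℕ // p.2 < p.1 ∧ 0 < p.2}, 1 / ((p.1.1 : ℝ) ^ j * (p.1.2 : ℝ) ^ l)

/-- The Riemann zeta value `ζ(k) = Σ_{m>0} 1/m^k`. -/
noncomputable def singleZeta (k : ℕ) : ℝ :=
  ∑' m : {m : ℕ // 0 < m}, 1 / (m.1 : ℝ) ^ k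

open Finset Filter Topology

theorem tsum_nat_prod_eq_tsum_diag_add_tsum_offDiag {f : ℕ × ℕ → ℝ} (hf : Summable f) :
    ∑' p, f p = ∑' a, f (a, a) +
      ∑' p : ℕ × ℕ, (f (p.1, p.1 + p.2 + 1) + f (p.1 + p.2 + 1, p.1)) := by
  let φ : ℕ ⊕ (ℕ × ℕ) ⊕ (ℕ × ℕ) → ℕ × ℕ :=
    Sum.elim (fun a => (a, a)) (Sum.elim (fun p => (p.1, p.1 + p.2 + 1))
      (fun p => (p.1 + p.2 + 1, p.1)))
  have hinj : Function.Injective φ := by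
    rintro (a | ⟨a, d⟩ | ⟨a, d⟩) (a' | ⟨a', d'⟩ | ⟨a', d'⟩) h <;>
      simp [φ, Prod.ext_iff] at h ⊢ <;> omega
  have hsurj : Function.Surjective φ := by
    rintro ⟨a, b⟩
    rcases lt_trichotomy a b with h | h | h
    · exact ⟨Sum.inr (Sum.inl (a, b - a - 1)), by simp [φ]; omega⟩
    · exact ⟨Sum.inl a, by simp [φ, h]⟩
    · exact ⟨Sum.inr (Sum.inr (b, a - b - 1)), by simp [φ]; omega⟩
  have h1 : Summable fun a => f (a, a) :=
    hf.comp_injective (i := fun a : ℕ => (a, a)) fun a b h => by simpa using h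
  have h2 : Summable fun p : ℕ × ℕ => f (p.1, p.1 + p.2 + 1) :=
    hf.comp_injective (hinj.comp (Sum.inr_injective.comp Sum.inl_injective))
  have h3 : Summable fun p : ℕ × ℕ => f (p.1 + p.2 + 1, p.1) :=
    hf.comp_injective (hinj.comp (Sum.inr_injective.comp Sum.inr_injective))
  have key : HasSum (f ∘ φ) (∑' a, f (a, a) +
      (∑' p : ℕ × ℕ, f (p.1, p.1 + p.2 + 1) + ∑' p : ℕ × ℕ, f (p.1 + p.2 + 1, p.1))) :=
    HasSum.sum h1.hasSum (HasSum.sum h2.hasSum h3.hasSum)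
  rw [h2.tsum_add h3]
  exact ((Equiv.ofBijective φ ⟨hinj, hsurj⟩).hasSum_iff.1 key).tsum_eq

theorem hasSum_one_div_sub_one_div_add (N : ℕ) :
    HasSum (fun d : ℕ => 1 / ((d : ℝ) + 1) - 1 / ((d : ℝ) + 1 + N))
      (∑ i ∈ range N, 1 / ((i : ℝ) + 1)) := by
  induction N with
  | zero => simp
  | succ N ih =>
    rw [sum_range_succ]
    have h : HasSum (fun d : ℕ => 1 / ((d : ℝ) + 1 + N) - 1 / ((d : ℝ) + 1 + (N + 1 : ℕ)))
        (1 / ((N : ℝ) + 1)) := by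
      rw [hasSum_iff_tendsto_nat_of_nonneg]
      · have e (n : ℕ) : ∑ d ∈ range n, (1 / ((d : ℝ) + 1 + N) - 1 / ((d : ℝ) + 1 + (N + 1 : ℕ)))
            = 1 / ((N : ℝ) + 1) - 1 / ((n + N : ℕ) + 1 : ℝ) := by
          have := sum_range_sub' (fun d : ℕ => 1 / ((d : ℝ) + 1 + N)) n
          convert this using 2 <;> push_cast <;> ring_nf
        simp_rw [e]
        simpa using (tendsto_const_nhds (x := 1 / ((N : ℝ) + 1))).sub
          ((tendsto_add_atTop_iff_nat N).2 (tendsto_one_div_add_atTop_nhds_zero_nat (𝕜 := ℝ)))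
      · intro d
        rw [sub_nonneg]
        push_cast
        exact one_div_le_one_div_of_le (by positivity) (by linarith)
    refine (ih.add h).congr_fun ?_
    intro d
    ring

theorem sum_two_pow_div_mul (n : ℕ) {a b : ℝ} (ha : 0 < a) (hb : 0 < b) :
    (∑ i ∈ range n, 2 ^ (i + 2) * (1 / ((a + b) ^ (i + 2) * a ^ (n - i)))) * (b - a)
      = 4 / (a ^ n * (a + b)) - 2 ^ (n + 2) / (a + b) ^ (n + 1) := by
  have h := (Commute.all (2 / (a + b)) (1 / a)).geom_sum₂_mul n
  have e : ∑ i ∈ range n, 2 ^ (i + 2) * (1 / ((a + b) ^ (i + 2) * a ^ (n - i)))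
      = (2 / (a + b)) ^ 2 * (1 / a) *
        ∑ i ∈ range n, (2 / (a + b)) ^ i * (1 / a) ^ (n - 1 - i) := by
    rw [mul_sum]
    refine sum_congr rfl fun i hi => ?_
    have : n - i = (n - 1 - i) + 1 := by have := mem_range.1 hi; omega
    rw [this]
    simp only [div_pow, one_pow, pow_succ]
    field_simp
  have hba : b - a = -(a * (a + b)) * (2 / (a + b) - 1 / a) := by
    field_simp
    ring
  rw [e, hba]
  calc _ = -((2 / (a + b)) ^ 2 * (a + b)) * (1 / a * a) *
        ((∑ i ∈ range n, (2 / (a + b)) ^ i * (1 / a) ^ (n - 1 - i)) * (2 / (a + b) - 1 / a)) := by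
        ring
    _ = _ := by
        rw [h]
        simp only [div_pow, one_pow]
        field_simp
        ring

theorem sum_two_pow_div_self (n : ℕ) {a : ℝ} (ha : 0 < a) :
    ∑ i ∈ range n, 2 ^ (i + 2) * (1 / ((a + a) ^ (i + 2) * a ^ (n - i)))
      = n * (1 / a ^ (n + 2)) := by
  rw [← nsmul_eq_mul, ← card_range n, ← sum_const, card_range]
  refine sum_congr rfl fun i hi => ?_
  have : n + 2 = (i + 2) + (n - i) := by have := mem_range.1 hi; omega
  rw [this, ← two_mul, mul_pow, pow_add a (i + 2)]
  field_simp

theorem sum_two_pow_div_add_swap (n : ℕ) {a d : ℝ} (ha : 0 < a) (hd : 0 < d) :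
    ∑ i ∈ range n, 2 ^ (i + 2) * (1 / ((a + (a + d)) ^ (i + 2) * a ^ (n - i))) +
      ∑ i ∈ range n, 2 ^ (i + 2) * (1 / (((a + d) + a) ^ (i + 2) * (a + d) ^ (n - i)))
      = 4 / (a ^ n * (d * (2 * a + d))) - 4 / ((a + d) ^ n * (d * (2 * a + d))) := by
  have h1 := sum_two_pow_div_mul n ha (add_pos ha hd)
  have h2 := sum_two_pow_div_mul n (add_pos ha hd) ha
  rw [← eq_div_iff (by simp [hd.ne'])] at h1 h2
  rw [h1, h2]
  have e1 : a + (a + d) = 2 * a + d := by ring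
  have e2 : a + d + a = 2 * a + d := by ring
  have e3 : a + d - a = d := by ring
  have e4 : a - (a + d) = -d := by ring
  rw [e1, e2, e3, e4]
  field_simp
  ring

theorem summable_one_div_rpow_mul_rpow :
    Summable fun p : ℕ × ℕ =>
      1 / (((p.1 : ℝ) + 1) ^ (3 / 2 : ℝ) * ((p.2 : ℝ) + 1) ^ (3 / 2 : ℝ)) := by
  have h : Summable fun n : ℕ => 1 / ((n : ℝ) + 1) ^ (3 / 2 : ℝ) := by
    simpa using (summable_nat_add_iff 1).2
      (Real.summable_one_div_nat_rpow (p := 3 / 2).2 (by norm_num))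
  refine (h.mul_of_nonneg h (fun n => ?_) (fun n => ?_)).congr fun p => ?_
  · positivity
  · positivity
  · rw [one_div_mul_one_div]

theorem rpow_mul_rpow_le_mul_mul_add {x y : ℝ} (hx : 0 < x) (hy : 0 < y) :
    x ^ (3 / 2 : ℝ) * y ^ (3 / 2 : ℝ) ≤ x * y * (x + y) := by
  have e (z : ℝ) (hz : 0 < z) : z ^ (3 / 2 : ℝ) = z * √z := by
    rw [Real.sqrt_eq_rpow, ← Real.rpow_one_add' hz.le (by norm_num)]
    norm_num
  rw [e x hx, e y hy]
  have : √x * √y ≤ x + y := by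
    nlinarith [Real.sq_sqrt hx.le, Real.sq_sqrt hy.le, sq_nonneg (√x - √y), Real.sqrt_nonneg x,
      Real.sqrt_nonneg y, mul_nonneg (Real.sqrt_nonneg x) (Real.sqrt_nonneg y)]
  calc x * √x * (y * √y) = x * y * (√x * √y) := by ring
    _ ≤ _ := by gcongr

theorem summable_one_div_mul_mul_add :
    Summable fun p : ℕ × ℕ =>
      1 / (((p.1 : ℝ) + 1) * ((p.2 : ℝ) + 1) * (((p.1 : ℝ) + 1) + ((p.2 : ℝ) + 1))) :=
  Summable.of_nonneg_of_le (fun p => by positivity)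
    (fun p => one_div_le_one_div_of_le (by positivity)
      (rpow_mul_rpow_le_mul_mul_add (by positivity) (by positivity)))
    summable_one_div_rpow_mul_rpow

theorem summable_one_div_add_pow_mul_pow {j l : ℕ} (hj : 2 ≤ j) (hl : 1 ≤ l) :
    Summable fun p : ℕ × ℕ =>
      1 / ((((p.1 : ℝ) + 1) + ((p.2 : ℝ) + 1)) ^ j * ((p.1 : ℝ) + 1) ^ l) := by
  refine Summable.of_nonneg_of_le (fun p => by positivity) (fun p => ?_)
    summable_one_div_mul_mul_add
  refine one_div_le_one_div_of_le (by positivity) ?_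
  have hx : (1 : ℝ) ≤ (p.1 : ℝ) + 1 := by simp
  have hy : (1 : ℝ) ≤ (p.2 : ℝ) + 1 := by simp
  generalize (p.1 : ℝ) + 1 = x at *
  generalize (p.2 : ℝ) + 1 = y at *
  calc x * y * (x + y) = (y * (x + y)) * x ^ 1 := by ring
    _ ≤ (x + y) ^ 2 * x ^ 1 := by gcongr; nlinarith
    _ ≤ (x + y) ^ j * x ^ l := by gcongr; linarith

theorem doubleZeta_eq_tsum (j l : ℕ) :
    doubleZeta j l = ∑' p : ℕ × ℕ,
      1 / ((((p.1 : ℝ) + 1) + ((p.2 : ℝ) + 1)) ^ j * ((p.1 : ℝ) + 1) ^ l) := by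
  let e : ℕ × ℕ ≃ {p : ℕ × ℕ // p.2 < p.1 ∧ 0 < p.2} :=
    { toFun := fun p => ⟨(p.1 + 1 + (p.2 + 1), p.1 + 1), by simp⟩
      invFun := fun q => (q.1.2 - 1, q.1.1 - q.1.2 - 1)
      left_inv := fun p => by ext <;> simp
      right_inv := fun q => by
        obtain ⟨⟨m, n⟩, h⟩ := q
        simp only [Subtype.mk.injEq, Prod.mk.injEq]
        simp only at h
        omega }
  rw [doubleZeta, ← e.tsum_eq]
  simp [e]

theorem singleZeta_eq_tsum (k : ℕ) : singleZeta k = ∑' a : ℕ, 1 / ((a : ℝ) + 1) ^ k := by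
  let e : ℕ ≃ {m : ℕ // 0 < m} :=
    { toFun := fun a => ⟨a + 1, a.succ_pos⟩
      invFun := fun m => m.1 - 1
      left_inv := fun a => by simp
      right_inv := fun m => Subtype.ext (Nat.sub_add_cancel m.2) }
  rw [singleZeta, ← e.tsum_eq]
  simp [e]

theorem summable_one_div_add_one_pow {k : ℕ} (hk : 2 ≤ k) :
    Summable fun a : ℕ => 1 / ((a : ℝ) + 1) ^ k := by
  simpa using (summable_nat_add_iff 1).2 (Real.summable_one_div_nat_pow (p := k).2 (by omega))

theorem summable_four_div {n : ℕ} (hn : 1 ≤ n) :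
    Summable fun p : ℕ × ℕ => 4 / (((p.1 : ℝ) + 1) ^ n *
      (((p.2 : ℝ) + 1) * (2 * ((p.1 : ℝ) + 1) + ((p.2 : ℝ) + 1)))) := by
  refine Summable.of_nonneg_of_le (fun p => by positivity) (fun p => ?_)
    (summable_one_div_mul_mul_add.mul_left 4)
  have hx : (1 : ℝ) ≤ (p.1 : ℝ) + 1 := by simp
  have hy : (1 : ℝ) ≤ (p.2 : ℝ) + 1 := by simp
  generalize (p.1 : ℝ) + 1 = x at *
  generalize (p.2 : ℝ) + 1 = y at *
  rw [mul_one_div]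
  have : x ≤ x ^ n := le_self_pow₀ hx (by omega)
  rw [mul_assoc]
  gcongr
  linarith

theorem summable_four_div_add_pow {n : ℕ} (hn : 1 ≤ n) :
    Summable fun p : ℕ × ℕ => 4 / (((p.1 : ℝ) + 1 + ((p.2 : ℝ) + 1)) ^ n *
      (((p.2 : ℝ) + 1) * (2 * ((p.1 : ℝ) + 1) + ((p.2 : ℝ) + 1)))) := by
  refine Summable.of_nonneg_of_le (fun p => by positivity) (fun p => ?_) (summable_four_div hn)
  have : (0 : ℝ) ≤ p.2 := p.2.cast_nonneg
  gcongr <;> linarith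

theorem hasSum_four_div {n : ℕ} (hn : 1 ≤ n) :
    HasSum (fun a : ℕ => 2 / ((a : ℝ) + 1) ^ (n + 1) *
      ∑ i ∈ range (2 * a + 2), 1 / ((i : ℝ) + 1))
      (∑' p : ℕ × ℕ, 4 / (((p.1 : ℝ) + 1) ^ n *
        (((p.2 : ℝ) + 1) * (2 * ((p.1 : ℝ) + 1) + ((p.2 : ℝ) + 1))))) := by
  refine (summable_four_div hn).hasSum.prod_fiberwise fun a => ?_
  refine ((hasSum_one_div_sub_one_div_add (2 * a + 2)).mul_left
    (2 / ((a : ℝ) + 1) ^ (n + 1))).congr_fun fun d => ?_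
  push_cast
  field_simp
  ring

theorem sum_antidiagonal_one_div_add (m : ℕ) :
    ∑ p ∈ antidiagonal m, (1 / ((p.2 : ℝ) + 1) + 1 / (2 * ((p.1 : ℝ) + 1) + ((p.2 : ℝ) + 1)))
      = ∑ i ∈ range (2 * (m + 1) + 2), 1 / ((i : ℝ) + 1) - 3 / (2 * ((m : ℝ) + 2)) := by
  rw [sum_add_distrib, ← Nat.sum_antidiagonal_swap, Nat.sum_antidiagonal_eq_sum_range_succ_mk,
    Nat.sum_antidiagonal_eq_sum_range_succ_mk,
    show 2 * (m + 1) + 2 = (m + 1 + 1) + (m + 1) + 1 by ring, sum_range_succ _ (m + 1 + 1 + (m + 1)),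
    sum_range_add, sum_range_succ _ (m + 1)]
  have : ∑ i ∈ range (m + 1), 1 / (2 * ((i : ℝ) + 1) + (((m - i : ℕ) : ℝ) + 1))
      = ∑ i ∈ range (m + 1), 1 / (((m + 1 + 1 + i : ℕ) : ℝ) + 1) := by
    refine sum_congr rfl fun i hi => ?_
    rw [Nat.cast_sub (by have := mem_range.1 hi; omega)]
    push_cast
    ring_nf
  simp only [Prod.snd_swap, Nat.succ_eq_add_one]
  rw [this]
  push_cast
  field_simp
  ring

theorem hasSum_four_div_add_pow {n : ℕ} (hn : 1 ≤ n) :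
    HasSum (fun m : ℕ => 2 / ((m : ℝ) + 2) ^ (n + 1) *
      (∑ i ∈ range (2 * (m + 1) + 2), 1 / ((i : ℝ) + 1) - 3 / (2 * ((m : ℝ) + 2))))
      (∑' p : ℕ × ℕ, 4 / (((p.1 : ℝ) + 1 + ((p.2 : ℝ) + 1)) ^ n *
        (((p.2 : ℝ) + 1) * (2 * ((p.1 : ℝ) + 1) + ((p.2 : ℝ) + 1))))) := by
  refine HasSum.sigma (HasAntidiagonal.sigmaAntidiagonalEquivProd.hasSum_iff.2
    (summable_four_div_add_pow hn).hasSum) fun m => ?_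
  rw [← sum_antidiagonal_one_div_add, mul_sum, ← Finset.sum_coe_sort]
  refine (hasSum_fintype _).congr_fun fun p => ?_
  obtain ⟨⟨a, d⟩, h⟩ := p
  have hm : (m : ℝ) + 2 = (a : ℝ) + 1 + ((d : ℝ) + 1) := by
    rw [← mem_antidiagonal.1 h]
    push_cast
    ring
  simp only [Function.comp, HasAntidiagonal.sigmaAntidiagonalEquivProd_apply, hm]
  field_simp
  ring

theorem tsum_four_div_sub {n : ℕ} (hn : 1 ≤ n) :
    ∑' p : ℕ × ℕ, (4 / (((p.1 : ℝ) + 1) ^ n *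
        (((p.2 : ℝ) + 1) * (2 * ((p.1 : ℝ) + 1) + ((p.2 : ℝ) + 1)))) -
      4 / (((p.1 : ℝ) + 1 + ((p.2 : ℝ) + 1)) ^ n *
        (((p.2 : ℝ) + 1) * (2 * ((p.1 : ℝ) + 1) + ((p.2 : ℝ) + 1)))))
      = 3 * singleZeta (n + 2) := by
  rw [(summable_four_div hn).tsum_sub (summable_four_div_add_pow hn), sub_eq_iff_eq_add,
    ← sub_eq_iff_eq_add']
  have h := (hasSum_four_div hn).sub
    ((summable_one_div_add_one_pow (k := n + 2) (by omega)).hasSum.mul_left 3)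
  rw [← singleZeta_eq_tsum, ← hasSum_nat_add_iff' 1] at h
  have h' := (hasSum_four_div_add_pow hn).unique (h.congr_fun fun m => ?_)
  · rw [h']
    norm_num [sum_range_succ]
  · push_cast
    rw [show (m : ℝ) + 1 + 1 = m + 2 by ring, mul_sub]
    congr 1
    field_simp
    ring

theorem weighted_sum_formula_double_zeta (k : ℕ) (hk : 3 ≤ k) :
    ∑ j ∈ Finset.Icc 2 (k - 1), (2 : ℝ) ^ j * doubleZeta j (k - j)
      = ((k : ℝ) + 1) * singleZeta k := by
  obtain ⟨n, rfl⟩ : ∃ n, k = n + 2 := ⟨k - 2, by omega⟩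
  have hn : 1 ≤ n := by omega
  let t : ℕ × ℕ → ℝ := fun p => ∑ i ∈ range n, 2 ^ (i + 2) *
    (1 / ((((p.1 : ℝ) + 1) + ((p.2 : ℝ) + 1)) ^ (i + 2) * ((p.1 : ℝ) + 1) ^ (n - i)))
  have hs : ∀ i ∈ range n, Summable fun p : ℕ × ℕ => (2 : ℝ) ^ (i + 2) *
      (1 / ((((p.1 : ℝ) + 1) + ((p.2 : ℝ) + 1)) ^ (i + 2) * ((p.1 : ℝ) + 1) ^ (n - i))) :=
    fun i hi => (summable_one_div_add_pow_mul_pow (by omega)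
      (by have := mem_range.1 hi; omega)).mul_left _
  have ht : Summable t := summable_sum hs
  have hdiag (a : ℕ) : t (a, a) = n * (1 / ((a : ℝ) + 1) ^ (n + 2)) :=
    sum_two_pow_div_self n (by positivity)
  have hoff (p : ℕ × ℕ) : t (p.1, p.1 + p.2 + 1) + t (p.1 + p.2 + 1, p.1) =
      4 / (((p.1 : ℝ) + 1) ^ n *
        (((p.2 : ℝ) + 1) * (2 * ((p.1 : ℝ) + 1) + ((p.2 : ℝ) + 1)))) -
      4 / (((p.1 : ℝ) + 1 + ((p.2 : ℝ) + 1)) ^ n *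
        (((p.2 : ℝ) + 1) * (2 * ((p.1 : ℝ) + 1) + ((p.2 : ℝ) + 1)))) := by
    rw [← sum_two_pow_div_add_swap n (by positivity) (by positivity)]
    simp only [t]
    push_cast
    rw [show (p.1 : ℝ) + p.2 + 1 + 1 = p.1 + 1 + (p.2 + 1) by ring]
  calc ∑ j ∈ Finset.Icc 2 (n + 2 - 1), (2 : ℝ) ^ j * doubleZeta j (n + 2 - j)
      = ∑ i ∈ range n, (2 : ℝ) ^ (i + 2) * doubleZeta (i + 2) (n - i) := by
        rw [← Finset.Ico_add_one_right_eq_Icc, sum_Ico_eq_sum_range]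
        refine sum_congr (by congr 1) fun i _ => ?_
        rw [add_comm 2 i, Nat.add_sub_add_right]
    _ = ∑' p, t p := by
        rw [Summable.tsum_finsetSum hs]
        exact sum_congr rfl fun i _ => by rw [tsum_mul_left, doubleZeta_eq_tsum]
    _ = n * singleZeta (n + 2) + 3 * singleZeta (n + 2) := by
        rw [tsum_nat_prod_eq_tsum_diag_add_tsum_offDiag ht, ← tsum_four_div_sub hn,
          singleZeta_eq_tsum, ← tsum_mul_left]
        simp_rw [hdiag, hoff]
    _ = (((n + 2 : ℕ) : ℝ) + 1) * singleZeta (n + 2) := by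
        push_cast
        ring
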